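/- Let M_rel, M_H, and M_con be STRIPS models over the same facts F and actions A such that M_con is at least as constrained as M_H and M_H is at least as constrained as M_rel, and let c : A → ℝ be a cost function with c(a) ≥ 0 for all a. If the problem (I, G) has at least one valid plan in M_con, then it has valid plans in all three models, and the optimal costs satisfy C*_{M_rel} ≤ C*_{M_H} ≤ C*_{M_con}. -/

import Mathlib

/-- A STRIPS model over facts `F` and actions `A`. -/
structure Strips (F A : Type*) where
  pre : A → Set F
  add : A → Set F
  del : A → Set F

namespace Strips

variable {F A : Type*}

/-- Result of applying action `a` in state `s`. -/
def apply (M : Strips F A) (s : Set F) (a : A) : Set F :=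
  (s ∪ M.add a) \ M.del a

/-- A plan is executable from a state if each action is applicable
(its precondition holds) at the state where it is applied. -/
def Exec (M : Strips F A) : Set F → List A → Prop
  | _, [] => True
  | s, a :: π => M.pre a ⊆ s ∧ M.Exec (M.apply s a) π

/-- The final state reached by applying a plan from a state. -/
def final (M : Strips F A) : Set F → List A → Set F
  | s, [] => s
  | s, a :: π => M.final (M.apply s a) π

/-- A plan is valid for problem `(I, G)` if it is executable from `I`
and the final state contains `G`. -/
def Valid (M : Strips F A) (I G : Set F) (π : List A) : Prop :=
  M.Exec I π ∧ G ⊆ M.final I π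

/-- `M₁` is at least as constrained as `M₂`. -/
def MoreConstrained (M₁ M₂ : Strips F A) : Prop :=
  ∀ a, M₂.pre a ⊆ M₁.pre a ∧ M₁.add a ⊆ M₂.add a ∧ M₂.del a ⊆ M₁.del a

/-- The cost of a plan: the sum of action costs, with multiplicity. -/
def planCost (c : A → ℝ) (π : List A) : ℝ := (π.map c).sum

/-- The optimal cost of problem `(I, G)` in model `M`:
the infimum of the costs of its valid plans. -/
noncomputable def optCost (M : Strips F A) (c : A → ℝ) (I G : Set F) : ℝ :=
  sInf (planCost c '' {π | M.Valid I G π})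

end Strips

namespace Strips

variable {F A : Type*} {M₁ M₂ : Strips F A}

theorem MoreConstrained.apply_subset (h : M₁.MoreConstrained M₂) {s t : Set F} (hst : s ⊆ t)
    (a : A) : M₁.apply s a ⊆ M₂.apply t a :=
  Set.sdiff_subset_sdiff (Set.union_subset_union hst (h a).2.1) (h a).2.2

theorem MoreConstrained.exec (h : M₁.MoreConstrained M₂) {s t : Set F} (hst : s ⊆ t)
    {π : List A} (hπ : M₁.Exec s π) : M₂.Exec t π := by
  induction π generalizing s t with
  | nil => trivial
  | cons a π ih =>
    exact ⟨((h a).1.trans hπ.1).trans hst, ih (h.apply_subset hst a) hπ.2⟩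

theorem MoreConstrained.final_subset (h : M₁.MoreConstrained M₂) {s t : Set F} (hst : s ⊆ t)
    (π : List A) : M₁.final s π ⊆ M₂.final t π := by
  induction π generalizing s t with
  | nil => exact hst
  | cons a π ih => exact ih (h.apply_subset hst a)

theorem MoreConstrained.valid (h : M₁.MoreConstrained M₂) {I G : Set F} {π : List A}
    (hπ : M₁.Valid I G π) : M₂.Valid I G π :=
  ⟨h.exec subset_rfl hπ.1, hπ.2.trans (h.final_subset subset_rfl π)⟩

theorem planCost_nonneg {c : A → ℝ} (hc : ∀ a, 0 ≤ c a) (π : List A) : 0 ≤ planCost c π :=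
  List.sum_nonneg (by simpa using fun a _ => hc a)

theorem MoreConstrained.optCost_le (h : M₁.MoreConstrained M₂) {c : A → ℝ} (hc : ∀ a, 0 ≤ c a)
    {I G : Set F} (hne : ∃ π : List A, M₁.Valid I G π) :
    M₂.optCost c I G ≤ M₁.optCost c I G := by
  refine csInf_le_csInf ⟨0, ?_⟩ (Set.Nonempty.image _ hne)
    (Set.image_mono fun _ hπ => h.valid hπ)
  rintro _ ⟨π, -, rfl⟩
  exact planCost_nonneg hc π

end Strips

theorem optCost_rel_le_H_le_con {F A : Type*}
    (Mrel MH Mcon : Strips F A)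
    (hconH : Mcon.MoreConstrained MH) (hHrel : MH.MoreConstrained Mrel)
    (c : A → ℝ) (hc : ∀ a, 0 ≤ c a)
    (I G : Set F) (hne : ∃ π : List A, Mcon.Valid I G π) :
    ((∃ π : List A, Mcon.Valid I G π) ∧ (∃ π : List A, MH.Valid I G π) ∧
      (∃ π : List A, Mrel.Valid I G π)) ∧
      Mrel.optCost c I G ≤ MH.optCost c I G ∧
      MH.optCost c I G ≤ Mcon.optCost c I G := by
  have hH : ∃ π : List A, MH.Valid I G π := hne.imp fun _ => hconH.valid
  exact ⟨⟨hne, hH, hH.imp fun _ => hHrel.valid⟩, hHrel.optCost_le hc hH, hconH.optCost_le hc hne⟩
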